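/- Let D be a digraph containing no oriented path P(k,l,r) with k,l,r ≥ 2, k+l+r = n−1 and k ≤ r ≤ l. Then the chromatic number of D is at most 2(n+l−1)−k. -/

import Mathlib

/-- `ContainsP3 D k l r` : the digraph `D` contains the oriented path
`P(k,l,r)` consisting of `k` forward arcs, then `l` backward arcs, then `r`
forward arcs. -/
def ContainsP3 {V : Type*} (D : V → V → Prop) (k l r : ℕ) : Prop :=
  ∃ x : Fin (k + l + r + 1) → V, Function.Injective x ∧
    (∀ i : ℕ, ∀ _ : i < k, D (x ⟨i, by omega⟩) (x ⟨i + 1, by omega⟩)) ∧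
    (∀ i : ℕ, ∀ _ : k ≤ i ∧ i < k + l, D (x ⟨i + 1, by omega⟩) (x ⟨i, by omega⟩)) ∧
    (∀ i : ℕ, ∀ _ : k + l ≤ i ∧ i < k + l + r, D (x ⟨i, by omega⟩) (x ⟨i + 1, by omega⟩))

/-- `f 0, …, f m` is a directed path of length `m` for the relation `R`, with vertices in `S`. -/
structure IsDiPath {V : Type*} (R : V → V → Prop) (S : Set V) (m : ℕ) (f : ℕ → V) : Prop where
  rel : ∀ i < m, R (f i) (f (i + 1))
  mem : ∀ i ≤ m, f i ∈ S
  inj : ∀ i ≤ m, ∀ j ≤ m, f i = f j → i = j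

/-- Two directed paths inside `S`, of lengths `k` and `l`, sharing exactly their first vertex. -/
def ContainsFork {V : Type*} (R : V → V → Prop) (S : Set V) (k l : ℕ) : Prop :=
  ∃ f g : ℕ → V, IsDiPath R S k f ∧ IsDiPath R S l g ∧ f 0 = g 0 ∧
    ∀ i ≤ k, ∀ j ≤ l, 0 < i → f i ≠ g j

/-- `S` can be properly coloured, with respect to the arcs of `R`, with `m` colours. -/
def ColorableOn {V : Type*} (R : V → V → Prop) (S : Set V) (m : ℕ) : Prop :=
  ∃ c : V → ℕ, (∀ v ∈ S, c v < m) ∧ ∀ x ∈ S, ∀ y ∈ S, R x y → x ≠ y → c x ≠ c y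

theorem ColorableOn.flip {V : Type*} {R : V → V → Prop} {S : Set V} {m : ℕ}
    (h : ColorableOn R S m) : ColorableOn (flip R) S m := by
  obtain ⟨c, hc, hp⟩ := h
  exact ⟨c, hc, fun x hx y hy hxy hne => (hp y hy x hx hxy hne.symm).symm⟩

theorem ColorableOn.union {V : Type*} {R : V → V → Prop} {S T : Set V} {m n : ℕ}
    (hS : ColorableOn R S m) (hT : ColorableOn R T n) : ColorableOn R (S ∪ T) (m + n) := by
  classical
  obtain ⟨c, hc, hp⟩ := hS
  obtain ⟨d, hd, hq⟩ := hT
  refine ⟨fun v => if v ∈ S then c v else m + d v, ?_, ?_⟩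
  · rintro v hv
    by_cases h : v ∈ S
    · have := hc v h
      simp only [h, if_true]
      omega
    · have := hd v (hv.resolve_left h)
      simp only [h, if_false]
      omega
  · rintro x hx y hy hxy hne
    by_cases h : x ∈ S <;> by_cases h' : y ∈ S <;> simp only [h, h', if_true, if_false]
    · exact hp x h y h' hxy hne
    · have := hc x h
      omega
    · have := hc y h'
      omega
    · have := hq x (hx.resolve_left h) y (hy.resolve_left h') hxy hne
      omega

theorem ColorableOn.chromaticNumber_le {V : Type*} {R : V → V → Prop} {m n : ℕ}
    (h : ColorableOn R Set.univ m) (hmn : m ≤ n) :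
    (SimpleGraph.fromRel R).chromaticNumber ≤ (n : ℕ∞) := by
  obtain ⟨c, hc, hp⟩ := h
  refine SimpleGraph.Colorable.chromaticNumber_le (SimpleGraph.Colorable.mono hmn ?_)
  refine ⟨SimpleGraph.Coloring.mk (fun v => (⟨c v, hc v trivial⟩ : Fin m)) ?_⟩
  intro x y hxy heq
  have heq' : c x = c y := congrArg Fin.val heq
  rw [SimpleGraph.fromRel_adj] at hxy
  obtain ⟨hne, h | h⟩ := hxy
  · exact hp x trivial y trivial h hne heq'
  · exact hp y trivial x trivial h hne.symm heq'.symm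

theorem transGen_or_of_transGen_insert {V : Type*} {A : V → V → Prop} {x y u v : V}
    (h : Relation.TransGen (fun a b => A a b ∨ a = x ∧ b = y) u v) :
    Relation.TransGen A u v ∨ Relation.ReflTransGen A u x ∧ Relation.ReflTransGen A y v := by
  induction h with
  | single h =>
    obtain h | ⟨rfl, rfl⟩ := h
    · exact .inl (.single h)
    · exact .inr ⟨.refl, .refl⟩
  | tail _ h ih =>
    obtain h | ⟨rfl, rfl⟩ := h
    · obtain ih | ⟨h₁, h₂⟩ := ih
      · exact .inl (ih.tail h)
      · exact .inr ⟨h₁, h₂.tail h⟩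
    · obtain ih | ⟨h₁, _⟩ := ih
      · exact .inr ⟨ih.to_reflTransGen, .refl⟩
      · exact .inr ⟨h₁, .refl⟩

/-- A maximal acyclic subrelation of `R` on `S`, levelled by the length of a longest path, gives
levels such that adjacent vertices lie on different levels and every vertex of positive level has
an out-neighbour exactly one level below. -/
theorem exists_level {V : Type*} [Finite V] (R : V → V → Prop) (S : Set V) :
    ∃ lev : V → ℕ, (∀ x ∈ S, ∀ y ∈ S, R x y → x ≠ y → lev x ≠ lev y) ∧
      ∀ v ∈ S, 0 < lev v → ∃ u ∈ S, R v u ∧ lev u + 1 = lev v := by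
  classical
  cases nonempty_fintype V
  obtain ⟨A, hA⟩ := (Set.toFinite {A : V → V → Prop |
    (∀ a b, A a b → R a b ∧ a ∈ S ∧ b ∈ S) ∧ ∀ v, ¬ Relation.TransGen A v v}).exists_maximal
    ⟨fun _ _ => False, by simp, fun v h => by
      obtain ⟨_, _, h⟩ := Relation.TransGen.tail'_iff.1 h
      exact h⟩
  obtain ⟨hsub, hacyc⟩ := hA.prop
  have hwf : WellFounded (flip A) := by
    have : Std.Irrefl (Relation.TransGen (flip A)) :=
      ⟨fun v h => hacyc v (Relation.transGen_swap.1 h)⟩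
    exact Subrelation.wf (fun h => Relation.TransGen.single h)
      (Finite.wellFounded_of_trans_of_irrefl (Relation.TransGen (flip A)))
  let lev : V → ℕ := hwf.fix fun v ih =>
    Finset.univ.sup fun u => if h : A v u then ih u h + 1 else 0
  have hlev (v : V) : lev v = Finset.univ.sup fun u => if A v u then lev u + 1 else 0 := by
    simp only [lev]
    rw [hwf.fix_eq]
    simp only [dite_eq_ite]
  have hlt {a b : V} (h : A a b) : lev b < lev a := by
    have := Finset.le_sup (f := fun u => if A a u then lev u + 1 else 0) (Finset.mem_univ b)
    rw [← hlev a] at this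
    simpa [h] using this
  have hlt' {a b : V} (h : Relation.TransGen A a b) : lev b < lev a := by
    induction h with
    | single h => exact hlt h
    | tail _ h ih => exact (hlt h).trans ih
  refine ⟨lev, fun x hx y hy hxy hne => ?_, fun v _ hv => ?_⟩
  · by_cases hAxy : A x y
    · exact (hlt hAxy).ne'
    · have hnot : ¬ ∀ v, ¬ Relation.TransGen (fun a b => A a b ∨ a = x ∧ b = y) v v := by
        intro hac
        refine hAxy (hA.le_of_ge (y := fun a b => A a b ∨ a = x ∧ b = y) ⟨?_, hac⟩
          (fun a b h => Or.inl h) x y (Or.inr ⟨rfl, rfl⟩))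
        rintro a b (h | ⟨rfl, rfl⟩)
        · exact hsub a b h
        · exact ⟨hxy, hx, hy⟩
      push Not at hnot
      obtain ⟨v, hv⟩ := hnot
      obtain h | ⟨h₁, h₂⟩ := transGen_or_of_transGen_insert hv
      · exact absurd h (hacyc v)
      · obtain h | h := Relation.reflTransGen_iff_eq_or_transGen.1 (h₂.trans h₁)
        · exact absurd h hne
        · exact (hlt' h).ne
  · obtain ⟨u, -, hu⟩ := Finset.exists_mem_eq_sup (Finset.univ : Finset V) ⟨v, Finset.mem_univ v⟩
      fun u => if A v u then lev u + 1 else 0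
    rw [← hlev v] at hu
    by_cases h : A v u
    · simp only [h, if_true] at hu
      exact ⟨u, (hsub v u h).2.2, (hsub v u h).1, hu.symm⟩
    · simp only [h, if_false] at hu
      omega

theorem exists_path_of_le_level {V : Type*} {R : V → V → Prop} {S : Set V} {lev : V → ℕ}
    (hlev : ∀ v ∈ S, 0 < lev v → ∃ u ∈ S, R v u ∧ lev u + 1 = lev v) {v : V} (hv : v ∈ S)
    {m : ℕ} (hm : m ≤ lev v) :
    ∃ f : ℕ → V, IsDiPath R S m f ∧ f 0 = v ∧ ∀ i ≤ m, lev (f i) + i = lev v := by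
  choose! p hpS hpR hplev using hlev
  have key : ∀ i ≤ m, p^[i] v ∈ S ∧ lev (p^[i] v) + i = lev v := by
    intro i
    induction i with
    | zero => exact fun _ => ⟨hv, rfl⟩
    | succ i ih =>
      intro hi
      obtain ⟨h₁, h₂⟩ := ih (by omega)
      rw [Function.iterate_succ_apply']
      have := hplev _ h₁ (by omega)
      exact ⟨hpS _ h₁ (by omega), by omega⟩
  refine ⟨fun i => p^[i] v, ⟨fun i hi => ?_, fun i hi => (key i hi).1, fun i hi j hj h => ?_⟩, rfl,
    fun i hi => (key i hi).2⟩
  · rw [Function.iterate_succ_apply']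
    obtain ⟨hS, hi'⟩ := key i hi.le
    exact hpR _ hS (by omega)
  · have h₁ := (key i hi).2
    have h₂ := (key j hj).2
    rw [h] at h₁
    omega

/-- The Gallai–Roy theorem. -/
theorem colorableOn_of_no_path {V : Type*} [Finite V] {R : V → V → Prop} {S : Set V} {m : ℕ}
    (h : ¬ ∃ f, IsDiPath R S m f) : ColorableOn R S m := by
  obtain ⟨lev, hne, hlev⟩ := exists_level R S
  refine ⟨lev, fun v hv => ?_, hne⟩
  by_contra! hm
  obtain ⟨f, hf, -⟩ := exists_path_of_le_level hlev hv hm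
  exact h ⟨f, hf⟩

/-- A digraph without a fork with branches of lengths `k` and `l` is `k + l + 1`-colourable. -/
theorem colorableOn_of_not_containsFork {V : Type*} [Finite V] {R : V → V → Prop} {S : Set V}
    {k l : ℕ} (hk : 0 < k) (hl : 0 < l) (h : ¬ ContainsFork R S k l) :
    ColorableOn R S (k + (l + 1)) := by
  obtain ⟨lev, hne, hlev⟩ := exists_level R S
  have hcons {x y : V} {g : ℕ → V} {m : ℕ} (hx : x ∈ S) (hxy : R x y) (hg : IsDiPath R S m g)
      (hg0 : g 0 = y) (hxg : ∀ i ≤ m, x ≠ g i) :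
      IsDiPath R S (m + 1) (fun i => Nat.casesOn i x g) := by
    refine ⟨?_, ?_, ?_⟩
    · rintro (_ | i) hi
      · simpa [hg0] using hxy
      · exact hg.rel i (by omega)
    · rintro (_ | i) hi
      · exact hx
      · exact hg.mem i (by omega)
    · rintro (_ | i) hi (_ | j) hj hij
      · rfl
      · exact absurd hij (hxg j (by omega))
      · exact absurd hij.symm (hxg i (by omega))
      · rw [hg.inj i (by omega) j (by omega) hij]
  have hshort : ∀ x ∈ S, ∀ y ∈ S, k ≤ lev x → k ≤ lev y → R x y →
      lev x ≤ lev y + l ∧ lev y ≤ lev x + l := by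
    intro x hx y hy hkx hky hxy
    refine ⟨?_, ?_⟩ <;> by_contra! hjump
    · obtain ⟨g, hg, hg0, hglev⟩ := exists_path_of_le_level hlev hx (m := l) (by omega)
      obtain ⟨f, hf, hf0, hflev⟩ := exists_path_of_le_level hlev hy (m := k - 1) (by omega)
      have hf' := hcons hx hxy hf hf0 fun i hi hi' => by
        have := hflev i hi
        rw [← hi'] at this
        omega
      rw [Nat.sub_add_cancel hk] at hf'
      refine h ⟨_, g, hf', hg, hg0.symm, ?_⟩
      rintro (_ | i) hi j hj hi0 hij
      · omega
      · have h₁ := hflev i (by omega)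
        have h₂ := hglev j hj
        simp only at hij
        rw [hij] at h₁
        omega
    · obtain ⟨f, hf, hf0, hflev⟩ := exists_path_of_le_level hlev hx (m := k) (by omega)
      obtain ⟨g, hg, hg0, hglev⟩ := exists_path_of_le_level hlev hy (m := l - 1) (by omega)
      have hg' := hcons hx hxy hg hg0 fun i hi hi' => by
        have := hglev i hi
        rw [← hi'] at this
        omega
      rw [Nat.sub_add_cancel hl] at hg'
      refine h ⟨f, _, hf, hg', hf0, ?_⟩
      rintro i hi (_ | j) hj hi0 hij
      · have := hf.inj i hi 0 (by omega) (hij.trans hf0.symm)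
        omega
      · have h₁ := hflev i hi
        have h₂ := hglev j (by omega)
        simp only at hij
        rw [hij] at h₁
        omega
  refine ⟨fun v => if lev v < k then lev v else k + lev v % (l + 1), fun v _ => ?_, ?_⟩
  · have := Nat.mod_lt (lev v) (show l + 1 > 0 by omega)
    simp only
    split_ifs <;> omega
  · intro x hx y hy hxy hxy'
    have hne := hne x hx y hy hxy hxy'
    simp only
    split_ifs with h₁ h₂ h₂
    · exact hne
    · omega
    · omega
    · obtain ⟨h₃, h₄⟩ := hshort x hx y hy (by omega) (by omega) hxy
      intro heq
      have hmod : lev x ≡ lev y [MOD l + 1] := by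
        unfold Nat.ModEq
        omega
      obtain hle | hle := le_total (lev x) (lev y)
      · obtain ⟨c, hc⟩ := (Nat.modEq_iff_dvd' hle).1 hmod
        have : c ≠ 0 := by rintro rfl; omega
        have : l + 1 ≤ (l + 1) * c := Nat.le_mul_of_pos_right _ (by omega)
        omega
      · obtain ⟨c, hc⟩ := (Nat.modEq_iff_dvd' hle).1 hmod.symm
        have : c ≠ 0 := by rintro rfl; omega
        have : l + 1 ≤ (l + 1) * c := Nat.le_mul_of_pos_right _ (by omega)
        omega

/-- Glueing an in-path ending at `g 0`, a path `g` traversed against its arcs, and an out-path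
starting at `g l`. -/
theorem containsP3_of_paths {V : Type*} {D : V → V → Prop} {S₁ S₂ S₃ : Set V} {k l r : ℕ}
    {f g h : ℕ → V} (hf : IsDiPath (flip D) S₁ k f) (hg : IsDiPath (flip D) S₂ l g)
    (hh : IsDiPath D S₃ r h) (hfg : f 0 = g 0) (hgh : g l = h 0)
    (hfg' : ∀ i ≤ k, ∀ j ≤ l, 0 < i → f i ≠ g j) (hgh' : ∀ i ≤ l, ∀ j ≤ r, 0 < j → g i ≠ h j)
    (hfh' : ∀ i ≤ k, ∀ j ≤ r, 0 < i → 0 < j → f i ≠ h j) :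
    ContainsP3 D k l r := by
  refine ⟨fun i => if i.1 < k then f (k - i.1) else if i.1 ≤ k + l then g (i.1 - k)
    else h (i.1 - (k + l)), ?_, ?_, ?_, ?_⟩
  · rintro ⟨i, hi⟩ ⟨j, hj⟩ hij
    simp only [Fin.mk.injEq] at hij ⊢
    split_ifs at hij with h₁ h₂ h₃ h₄ h₅ h₆ h₇ h₈
    · have := hf.inj _ (by omega) _ (by omega) hij
      omega
    · exact absurd hij (hfg' _ (by omega) _ (by omega) (by omega))
    · exact absurd hij (hfh' _ (by omega) _ (by omega) (by omega) (by omega))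
    · exact absurd hij.symm (hfg' _ (by omega) _ (by omega) (by omega))
    · have := hg.inj _ (by omega) _ (by omega) hij
      omega
    · exact absurd hij (hgh' _ (by omega) _ (by omega) (by omega))
    · exact absurd hij.symm (hfh' _ (by omega) _ (by omega) (by omega) (by omega))
    · exact absurd hij.symm (hgh' _ (by omega) _ (by omega) (by omega))
    · have := hh.inj _ (by omega) _ (by omega) hij
      omega
  · intro i hi
    have := hf.rel (k - (i + 1)) (by omega)
    rw [show k - (i + 1) + 1 = k - i by omega] at this
    obtain hi' | hi' : i + 1 < k ∨ i + 1 = k := by omega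
    · simpa [hi, hi', flip] using this
    · rw [hi', Nat.sub_self, hfg] at this
      simpa [hi, hi', flip] using this
  · rintro i ⟨hi, hi'⟩
    have := hg.rel (i - k) (by omega)
    rw [show i - k + 1 = i + 1 - k by omega] at this
    simpa [show ¬ i < k by omega, show ¬ i + 1 < k by omega, show i ≤ k + l by omega,
      show i + 1 ≤ k + l by omega, flip] using this
  · rintro i ⟨hi, hi'⟩
    have := hh.rel (i - (k + l)) (by omega)
    rw [show i - (k + l) + 1 = i + 1 - (k + l) by omega] at this
    obtain rfl | hi'' : i = k + l ∨ k + l < i := by omega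
    · rw [Nat.sub_self, ← hgh] at this
      simpa [show ¬ k + l + 1 < k by omega] using this
    · simpa [show ¬ i < k by omega, show ¬ i + 1 < k by omega, show ¬ i ≤ k + l by omega,
        show ¬ i + 1 ≤ k + l by omega] using this

/-- A maximal vertex set without a directed path of length `k + r`: every other vertex starts a
path of length `r` or ends a path of length `k` whose remaining vertices lie in the set. -/
theorem exists_absorbing_set {V : Type*} [Finite V] (D : V → V → Prop) {k r : ℕ} (hk : 0 < k) :
    ∃ U : Set V, (¬ ∃ f, IsDiPath D U (k + r) f) ∧ ∀ v ∉ U,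
      (∃ f, IsDiPath D (insert v U) r f ∧ f 0 = v) ∨
        ∃ f, IsDiPath (flip D) (insert v U) k f ∧ f 0 = v := by
  obtain ⟨U, hU⟩ := (Set.toFinite {U : Set V | ¬ ∃ f, IsDiPath D U (k + r) f}).exists_maximal
    ⟨∅, fun ⟨f, hf⟩ => hf.mem 0 (by omega)⟩
  refine ⟨U, hU.prop, fun v hv => ?_⟩
  have hpath : ∃ f, IsDiPath D (insert v U) (k + r) f := by
    by_contra hno
    exact hv (hU.le_of_ge hno (Set.subset_insert v U) (Set.mem_insert v U))
  obtain ⟨f, hf⟩ := hpath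
  obtain ⟨j, hj, rfl⟩ : ∃ j ≤ k + r, f j = v := by
    by_contra! hno
    exact hU.prop ⟨f, hf.rel, fun i hi => (hf.mem i hi).resolve_left (hno i hi), hf.inj⟩
  obtain hjk | hjk := le_or_gt j k
  · refine .inl ⟨fun i => f (j + i), ⟨fun i hi => hf.rel (j + i) (by omega),
      fun i hi => hf.mem _ (by omega), fun i hi i' hi' h => ?_⟩, rfl⟩
    have := hf.inj _ (by omega) _ (by omega) h
    omega
  · refine .inr ⟨fun i => f (j - i), ⟨fun i hi => ?_, fun i hi => hf.mem _ (by omega),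
      fun i hi i' hi' h => ?_⟩, rfl⟩
    · have := hf.rel (j - (i + 1)) (by omega)
      rwa [show j - (i + 1) + 1 = j - i by omega] at this
    · have := hf.inj _ (by omega) _ (by omega) h
      omega

/-- Case 3 of Theorem 3.1: a `P(k,l,r)`-free digraph with `k+l+r = n-1`, `k,l,r ≥ 2`
and `k ≤ r ≤ l` has chromatic number at most `2 * (n + l - 1) - k`. -/
theorem three_blocks_case_3 {V : Type*} [Fintype V] (D : V → V → Prop) (n k l r : ℕ)
    (hk : 2 ≤ k) (hl : 2 ≤ l) (hr : 2 ≤ r)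
    (hsum : k + l + r = n - 1) (h1 : k ≤ r) (h2 : r ≤ l)
    (hfree : ¬ ContainsP3 D k l r) :
    (SimpleGraph.fromRel D).chromaticNumber ≤ ((2 * (n + l - 1) - k : ℕ) : ℕ∞) := by
  obtain ⟨U, hU, hcover⟩ := exists_absorbing_set D (k := k) (r := r) (by omega)
  have hmemU {R : V → V → Prop} {v : V} {m : ℕ} {f : ℕ → V} (hf : IsDiPath R (insert v U) m f)
      (hf0 : f 0 = v) {i : ℕ} (hi : i ≤ m) (hi0 : 0 < i) : f i ∈ U := by
    refine (hf.mem i hi).resolve_left fun h => ?_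
    have := hf.inj i hi 0 (by omega) (h.trans hf0.symm)
    omega
  let X : Set V := {v | v ∉ U ∧ ∃ f, IsDiPath D (insert v U) r f ∧ f 0 = v}
  let Y : Set V := {v | v ∉ U ∧ ∃ f, IsDiPath (flip D) (insert v U) k f ∧ f 0 = v}
  have hX : ColorableOn D X (k + (l + 1)) := by
    refine (colorableOn_of_not_containsFork (R := flip D) (by omega) (by omega) ?_).flip
    rintro ⟨f, g, hf, hg, hfg, hdisj⟩
    obtain ⟨-, h, hh, hh0⟩ := hg.mem l le_rfl
    exact hfree (containsP3_of_paths hf hg hh hfg hh0.symm hdisj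
      (fun i hi j hj hj0 heq => (hg.mem i hi).1 (heq ▸ hmemU hh hh0 hj hj0))
      (fun i hi j hj _ hj0 heq => (hf.mem i hi).1 (heq ▸ hmemU hh hh0 hj hj0)))
  have hY : ColorableOn D Y (r + (l + 1)) := by
    refine colorableOn_of_not_containsFork (by omega) (by omega) ?_
    rintro ⟨f, g, hf, hg, hfg, hdisj⟩
    obtain ⟨-, h, hh, hh0⟩ := hg.mem l le_rfl
    have hg' : IsDiPath (flip D) Y l (fun i => g (l - i)) := by
      refine ⟨fun i hi => ?_, fun i _ => hg.mem _ (by omega), fun i hi j hj hij => ?_⟩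
      · have := hg.rel (l - (i + 1)) (by omega)
        rwa [show l - (i + 1) + 1 = l - i by omega] at this
      · have := hg.inj _ (by omega) _ (by omega) hij
        omega
    exact hfree (containsP3_of_paths hh hg' hf hh0 (by simp [hfg])
      (fun i hi j hj hi0 heq => (hg'.mem j hj).1 (heq ▸ hmemU hh hh0 hi hi0))
      (fun i hi j hj hj0 heq => hdisj j hj (l - i) (by omega) hj0 heq.symm)
      (fun i hi j hj hi0 _ heq => (hf.mem j hj).1 (heq ▸ hmemU hh hh0 hi hi0)))
  have hall := ((colorableOn_of_no_path hU).union hX).union hY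
  have huniv : U ∪ X ∪ Y = Set.univ := by
    refine Set.eq_univ_of_forall fun v => ?_
    by_cases hv : v ∈ U
    · exact .inl (.inl hv)
    · obtain h | h := hcover v hv
      · exact .inl (.inr ⟨hv, h⟩)
      · exact .inr ⟨hv, h⟩
  rw [huniv] at hall
  exact hall.chromaticNumber_le (by omega)
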